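/- arXiv:2506.18417 — 3 statements merged into one kernel-verified Lean document; each statement's English description precedes it below -/
import Mathlib

section
/- Let ω ∈ (0,∞], m ∈ ℕ, and let e_i ∈ C¹([0,ω),ℝ^m) and e_{i+1} ∈ C([0,ω),ℝ^m) satisfy ė_i(t) = e_{i+1}(t) - k_i e_i(t) for all t ∈ [0,ω), where k_i > α ≥ 0. Let ψ ∈ C¹([0,ω),ℝ) satisfy ψ(t) > 0 and ψ̇(t) ≥ -α ψ(t) for all t ∈ [0,ω). Then for all t ∈ [0,ω), the function t ↦ ‖e_i(t)‖²/ψ(t)² is differentiable and (1/2) d/dt ( ‖e_i(t)‖²/ψ(t)² ) ≤ ( (α - k_i) · ‖e_i(t)‖/ψ(t) + ‖e_{i+1}(t)‖/ψ(t) ) · ( ‖e_i(t)‖/ψ(t) ). -/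
open Set
open scoped ENNReal

/-- The interval `[0, ω)` for `ω ∈ (0,∞]`, viewed as a subset of `ℝ`. -/
def funnelDomain (ω : ℝ≥0∞) : Set ℝ := {t : ℝ | 0 ≤ t ∧ ENNReal.ofReal t < ω}

/-- Computational core of the funnel-ratio lemma: the function `t ↦ ‖e_i(t)‖²/ψ(t)²`
is differentiable and satisfies the differential inequality
`(1/2) d/dt (‖e_i‖²/ψ²) ≤ ((α - k_i)‖e_i‖/ψ + ‖e_{i+1}‖/ψ) · ‖e_i‖/ψ`. -/
theorem stmt2 (m : ℕ) (ω : ℝ≥0∞) (hω : 0 < ω)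
    (α ki : ℝ) (hα : 0 ≤ α) (hki : α < ki)
    (ei : ℝ → EuclideanSpace ℝ (Fin m)) (ei1 : ℝ → EuclideanSpace ℝ (Fin m))
    (hderiv : ∀ t ∈ funnelDomain ω,
      HasDerivWithinAt ei (ei1 t - ki • ei t) (funnelDomain ω) t)
    (hei1cont : ContinuousOn ei1 (funnelDomain ω))
    (ψ ψ' : ℝ → ℝ)
    (hψderiv : ∀ t ∈ funnelDomain ω, HasDerivWithinAt ψ (ψ' t) (funnelDomain ω) t)
    (hψ'cont : ContinuousOn ψ' (funnelDomain ω))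
    (hψpos : ∀ t ∈ funnelDomain ω, 0 < ψ t)
    (hψ'lb : ∀ t ∈ funnelDomain ω, -α * ψ t ≤ ψ' t) :
    ∀ t ∈ funnelDomain ω,
      DifferentiableWithinAt ℝ (fun s => ‖ei s‖ ^ 2 / ψ s ^ 2) (funnelDomain ω) t ∧
      (1 / 2) * derivWithin (fun s => ‖ei s‖ ^ 2 / ψ s ^ 2) (funnelDomain ω) t ≤
        ((α - ki) * (‖ei t‖ / ψ t) + ‖ei1 t‖ / ψ t) * (‖ei t‖ / ψ t) := by
  intro t ht
  have huniq : UniqueDiffWithinAt ℝ (funnelDomain ω) t := by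
    have hconv : Convex ℝ (funnelDomain ω) := by
      apply Set.OrdConnected.convex
      refine ⟨fun x hx y hy z hz => ⟨hx.1.trans hz.1, ?_⟩⟩
      exact lt_of_le_of_lt (ENNReal.ofReal_le_ofReal hz.2) hy.2
    refine uniqueDiffWithinAt_convex hconv ?_ (subset_closure ht)
    obtain ⟨r, hr0, hr⟩ := ENNReal.lt_iff_exists_nnreal_btwn.1 hω
    have hr0' : (0 : ℝ) < r := by exact_mod_cast hr0
    have hsub : Ioo (0 : ℝ) r ⊆ funnelDomain ω := by
      intro z hz
      refine ⟨hz.1.le, lt_of_le_of_lt (ENNReal.ofReal_le_ofReal hz.2.le) ?_⟩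
      simpa using hr
    exact ⟨(r : ℝ) / 2, interior_maximal hsub isOpen_Ioo ⟨by linarith, by linarith⟩⟩
  have hp := hψpos t ht
  have h1 := (hderiv t ht).norm_sq
  have h2 := (hψderiv t ht).pow 2
  have h3 := h1.div h2 (pow_ne_zero 2 hp.ne')
  have h4 : HasDerivWithinAt (fun s => ‖ei s‖ ^ 2 / ψ s ^ 2) _ (funnelDomain ω) t := h3
  refine ⟨h4.differentiableWithinAt, ?_⟩
  rw [h4.derivWithin huniq]
  have hcs := real_inner_le_norm (ei t) (ei1 t)
  have hlb := hψ'lb t ht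
  simp only [inner_sub_right, inner_smul_right, real_inner_self_eq_norm_sq, Pi.pow_apply]
  set a := ‖ei t‖
  set b := ‖ei1 t‖
  set c := inner ℝ (ei t) (ei1 t)
  set p := ψ t
  have e1 : (1 / 2) * ((2 * (c - ki * a ^ 2) * p ^ 2 - a ^ 2 * (((2 : ℕ) : ℝ) * p ^ (2 - 1) * ψ' t)) / (p ^ 2) ^ 2)
      = ((c - ki * a ^ 2) * p - a ^ 2 * ψ' t) / p ^ 3 := by
    field_simp
    push_cast
    ring
  have e2 : ((α - ki) * (a / p) + b / p) * (a / p)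
      = (((α - ki) * a ^ 2 + a * b) * p) / p ^ 3 := by
    field_simp
  rw [e1, e2]
  apply div_le_div_of_nonneg_right _ (by positivity)
  nlinarith [mul_le_mul_of_nonneg_left hlb (sq_nonneg a), mul_le_mul_of_nonneg_right hcs hp.le]
end

section
/- Let r,m ∈ ℕ, ω ∈ (0,∞], α,β > 0, and k_1,…,k_{r-1} > α. Let y, y_ref ∈ C^{r-1}([0,ω),ℝ^m) with y_ref and all its derivatives up to order r-1 bounded, set e = y - y_ref, and define e_1(t) = e(t), e_{i+1}(t) = ė_i(t) + k_i e_i(t) for i = 1,…,r-1. Let ψ ∈ C¹([0,ω),ℝ) satisfy ψ(t) ≥ β/α and ψ̇(t) ≥ -α ψ(t) for all t ∈ [0,ω), and suppose ‖e_r(t)‖ < ψ(t) for all t ∈ [0,ω). Then for every i ∈ {0,1,…,r-1} there exists a constant κ_i > 0 such that ‖y^{(i)}(t)‖ ≤ κ_i ψ(t) for all t ∈ [0,ω). -/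
open Finset Set
open scoped ENNReal

theorem fd_mono {ω : ℝ≥0∞} {b t : ℝ} (hb : b ∈ funnelDomain ω) (h0 : 0 ≤ t) (h : t ≤ b) :
    t ∈ funnelDomain ω :=
  ⟨h0, lt_of_le_of_lt (ENNReal.ofReal_le_ofReal h) hb.2⟩

theorem fd_unique {ω : ℝ≥0∞} (hω : 0 < ω) : UniqueDiffOn ℝ (funnelDomain ω) := by
  have hc : (funnelDomain ω).OrdConnected :=
    ⟨fun x hx y hy z hz => fd_mono hy (hx.1.trans hz.1) hz.2⟩
  apply uniqueDiffOn_convex hc.convex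
  obtain ⟨b, hb0, hb⟩ := ENNReal.lt_iff_exists_nnreal_btwn.1 hω
  have hb0' : (0 : ℝ) < b := by exact_mod_cast hb0
  have hbm : (b : ℝ) ∈ funnelDomain ω := ⟨hb0'.le, by simpa using hb⟩
  refine ⟨(b : ℝ) / 2, ?_⟩
  rw [mem_interior]
  exact ⟨Ioo 0 b, fun t ht => fd_mono hbm ht.1.le ht.2.le, isOpen_Ioo, by constructor <;> linarith⟩

theorem fd_step {V : Type*} [NormedAddCommGroup V] [NormedSpace ℝ V] {ω : ℝ≥0∞} {α β k C : ℝ}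
    (hα : 0 < α) (hβ : 0 < β) (hk : α < k)
    (hC : 0 < C) (x z : ℝ → V) (ψ ψ' : ℝ → ℝ)
    (hψderiv : ∀ t ∈ funnelDomain ω, HasDerivWithinAt ψ (ψ' t) (funnelDomain ω) t)
    (hψlb : ∀ t ∈ funnelDomain ω, β / α ≤ ψ t)
    (hψ'lb : ∀ t ∈ funnelDomain ω, -α * ψ t ≤ ψ' t)
    (hx : ∀ t ∈ funnelDomain ω, HasDerivWithinAt x (z t - k • x t) (funnelDomain ω) t)
    (hz : ∀ t ∈ funnelDomain ω, ‖z t‖ ≤ C * ψ t) :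
    ∃ κ : ℝ, 0 < κ ∧ ∀ t ∈ funnelDomain ω, ‖x t‖ ≤ κ * ψ t := by
  have hpos : ∀ t ∈ funnelDomain ω, 0 < ψ t := fun t ht => (div_pos hβ hα).trans_le (hψlb t ht)
  have hkα : 0 < k - α := by linarith
  have hK : 0 < C / (k - α) := div_pos hC hkα
  refine ⟨max (C / (k - α)) (‖x 0‖ / ψ 0), lt_max_of_lt_left hK, fun b hb => ?_⟩
  set K := max (C / (k - α)) (‖x 0‖ / ψ 0) with hKd
  have hK1 : C ≤ K * (k - α) := (div_le_iff₀ hkα).1 (le_max_left _ _)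
  have h0 : (0 : ℝ) ∈ funnelDomain ω := fd_mono hb le_rfl hb.1
  have hK2 : ‖x 0‖ ≤ K * ψ 0 := (div_le_iff₀ (hpos 0 h0)).1 (le_max_right _ _)
  have hexp : ∀ t : ℝ, HasDerivAt (fun t => Real.exp (k * t)) (Real.exp (k * t) * k) t := by
    intro t
    have := ((hasDerivAt_id t).const_mul k).exp
    simpa using this
  have hf : ∀ t ∈ funnelDomain ω, HasDerivWithinAt (fun t => Real.exp (k * t) • x t)
      (Real.exp (k * t) • z t) (funnelDomain ω) t := by
    intro t ht
    have := (hexp t).hasDerivWithinAt.smul (hx t ht)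
    have heq : Real.exp (k * t) • z t
        = Real.exp (k * t) • (z t - k • x t) + (Real.exp (k * t) * k) • x t := by
      rw [smul_sub, smul_smul, sub_add_cancel]
    rw [heq]
    exact this
  have hB : ∀ t ∈ funnelDomain ω, HasDerivWithinAt (fun t => Real.exp (k * t) * (K * ψ t))
      (Real.exp (k * t) * k * (K * ψ t) + Real.exp (k * t) * (K * ψ' t)) (funnelDomain ω) t := by
    intro t ht
    exact (hexp t).hasDerivWithinAt.mul ((hψderiv t ht).const_mul K)
  have hsub : Icc 0 b ⊆ funnelDomain ω := fun t ht => fd_mono hb ht.1 ht.2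
  have hnh : ∀ t ∈ Ico 0 b, funnelDomain ω ∈ nhdsWithin t (Ici t) := fun t ht =>
    Filter.mem_of_superset (Icc_mem_nhdsGE ht.2) (fun s hs => hsub ⟨ht.1.trans hs.1, hs.2⟩)
  have key := image_norm_le_of_norm_deriv_right_le_deriv_boundary' (a := 0) (b := b)
    (f := fun t => Real.exp (k * t) • x t) (f' := fun t => Real.exp (k * t) • z t)
    (fun t ht => ((hf t (hsub ht)).continuousWithinAt).mono hsub)
    (fun t ht => (hf t (hsub ⟨ht.1, ht.2.le⟩)).mono_of_mem_nhdsWithin (hnh t ht))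
    (B := fun t => Real.exp (k * t) * (K * ψ t))
    (B' := fun t => Real.exp (k * t) * k * (K * ψ t) + Real.exp (k * t) * (K * ψ' t))
    (by simpa using hK2)
    (fun t ht => ((hB t (hsub ht)).continuousWithinAt).mono hsub)
    (fun t ht => (hB t (hsub ⟨ht.1, ht.2.le⟩)).mono_of_mem_nhdsWithin (hnh t ht))
    (by
      intro t ht
      have ht' := hsub ⟨ht.1, ht.2.le⟩
      have hKp : 0 < K := lt_max_of_lt_left hK
      have h1 := mul_le_mul_of_nonneg_right hK1 (hpos t ht').le
      have h2 := mul_le_mul_of_nonneg_left (hψ'lb t ht') hKp.le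
      rw [norm_smul, Real.norm_of_nonneg (Real.exp_pos _).le]
      have h3 : ‖z t‖ ≤ k * (K * ψ t) + K * ψ' t := by linarith [hz t ht']
      calc _ ≤ Real.exp (k * t) * (k * (K * ψ t) + K * ψ' t) :=
            mul_le_mul_of_nonneg_left h3 (Real.exp_pos _).le
        _ = _ := by ring)
    (x := b) ⟨hb.1, le_rfl⟩
  simp only [norm_smul, Real.norm_of_nonneg (Real.exp_pos _).le] at key
  exact le_of_mul_le_mul_left key (Real.exp_pos _)

def fdG {V : Type*} [NormedAddCommGroup V] [NormedSpace ℝ V] (k : ℕ → ℝ) (E : ℕ → ℝ → V) :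
    ℕ → ℕ → ℝ → V
  | 0, i => E i
  | j + 1, i => fun t => fdG k E j (i + 1) t - k i • fdG k E j i t

/-- Step 3 of the main proof: if `y, y_ref ∈ C^{r-1}` with `y_ref` and its derivatives
bounded, `e = y - y_ref`, the auxiliary signals satisfy `‖e_r(t)‖ < ψ(t)` where
`ψ ≥ β/α > 0` and `ψ̇ ≥ -αψ`, and `k_1,…,k_{r-1} > α`, then every derivative `y^{(i)}`,
`i = 0,…,r-1`, is bounded by a multiple of `ψ`. -/
theorem stmt6 (r m : ℕ) (hr : 1 ≤ r) (ω : ℝ≥0∞) (hω : 0 < ω)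
    (α β : ℝ) (hα : 0 < α) (hβ : 0 < β)
    (k : ℕ → ℝ) (hk : ∀ i, 1 ≤ i → i ≤ r - 1 → α < k i)
    (y yref : ℝ → EuclideanSpace ℝ (Fin m))
    -- `Y j` and `Yref j` are the `j`-th derivatives of `y` and `y_ref`, `j = 0,…,r-1`
    (Y Yref : ℕ → ℝ → EuclideanSpace ℝ (Fin m))
    (hY0 : Y 0 = y) (hYref0 : Yref 0 = yref)
    (hYderiv : ∀ j, j < r - 1 → ∀ t ∈ funnelDomain ω,
      HasDerivWithinAt (Y j) (Y (j + 1) t) (funnelDomain ω) t)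
    (hYcont : ContinuousOn (Y (r - 1)) (funnelDomain ω))
    (hYrefderiv : ∀ j, j < r - 1 → ∀ t ∈ funnelDomain ω,
      HasDerivWithinAt (Yref j) (Yref (j + 1) t) (funnelDomain ω) t)
    (hYrefcont : ContinuousOn (Yref (r - 1)) (funnelDomain ω))
    (hYrefbdd : ∀ j, j ≤ r - 1 → ∃ M : ℝ, ∀ t ∈ funnelDomain ω, ‖Yref j t‖ ≤ M)
    (e : ℝ → EuclideanSpace ℝ (Fin m)) (he : e = y - yref)
    (E : ℕ → ℝ → EuclideanSpace ℝ (Fin m))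
    (hE1 : E 1 = e)
    (hEderiv : ∀ i, 1 ≤ i → i ≤ r - 1 → ∀ t ∈ funnelDomain ω,
      HasDerivWithinAt (E i) (E (i + 1) t - k i • E i t) (funnelDomain ω) t)
    (ψ ψ' : ℝ → ℝ)
    (hψderiv : ∀ t ∈ funnelDomain ω, HasDerivWithinAt ψ (ψ' t) (funnelDomain ω) t)
    (hψ'cont : ContinuousOn ψ' (funnelDomain ω))
    (hψlb : ∀ t ∈ funnelDomain ω, β / α ≤ ψ t)
    (hψ'lb : ∀ t ∈ funnelDomain ω, -α * ψ t ≤ ψ' t)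
    (her : ∀ t ∈ funnelDomain ω, ‖E r t‖ < ψ t) :
    ∀ i, i ≤ r - 1 → ∃ κ : ℝ, 0 < κ ∧ ∀ t ∈ funnelDomain ω, ‖Y i t‖ ≤ κ * ψ t := by
  have hpos : ∀ t ∈ funnelDomain ω, 0 < ψ t := fun t ht => (div_pos hβ hα).trans_le (hψlb t ht)
  have hEb : ∀ n, n + 1 ≤ r → ∃ κ : ℝ, 0 < κ ∧ ∀ t ∈ funnelDomain ω, ‖E (r - n) t‖ ≤ κ * ψ t := by
    intro n
    induction n with
    | zero => exact fun _ => ⟨1, one_pos, fun t ht => by simpa using (her t ht).le⟩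
    | succ n ih =>
      intro hn
      obtain ⟨C, hC, hz⟩ := ih (by omega)
      have h1 : 1 ≤ r - (n + 1) := by omega
      have h2 : r - (n + 1) ≤ r - 1 := by omega
      have h3 : r - (n + 1) + 1 = r - n := by omega
      exact fd_step hα hβ (hk _ h1 h2) hC _ (E (r - n)) ψ ψ' hψderiv hψlb hψ'lb
        (h3 ▸ hEderiv _ h1 h2) hz
  have hGb : ∀ j i, 1 ≤ i → i + j ≤ r →
      ∃ κ : ℝ, 0 < κ ∧ ∀ t ∈ funnelDomain ω, ‖fdG k E j i t‖ ≤ κ * ψ t := by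
    intro j
    induction j with
    | zero =>
      intro i hi hir
      have := hEb (r - i) (by omega)
      rwa [show r - (r - i) = i by omega] at this
    | succ j ih =>
      intro i hi hir
      obtain ⟨a, ha, h1⟩ := ih (i + 1) (by omega) (by omega)
      obtain ⟨b, hb, h2⟩ := ih i hi (by omega)
      refine ⟨a + |k i| * b, by positivity, fun t ht => ?_⟩
      have h3 : ‖fdG k E j (i + 1) t - k i • fdG k E j i t‖ ≤ _ := norm_sub_le _ _
      rw [norm_smul, Real.norm_eq_abs] at h3
      have h4 := mul_le_mul_of_nonneg_left (h2 t ht) (abs_nonneg (k i))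
      have h5 := h1 t ht
      show ‖fdG k E j (i + 1) t - k i • fdG k E j i t‖ ≤ _
      linarith
  have hGd : ∀ j i, 1 ≤ i → i + j ≤ r - 1 → ∀ t ∈ funnelDomain ω,
      HasDerivWithinAt (fdG k E j i) (fdG k E (j + 1) i t) (funnelDomain ω) t := by
    intro j
    induction j with
    | zero => exact fun i hi hir t ht => hEderiv i hi hir t ht
    | succ j ih =>
      intro i hi hir t ht
      exact (ih (i + 1) (by omega) (by omega) t ht).sub
        ((ih i hi (by omega) t ht).const_smul (k i))
  have hD : ∀ j, j ≤ r - 1 → ∀ t ∈ funnelDomain ω, Y j t - Yref j t = fdG k E j 1 t := by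
    intro j
    induction j with
    | zero =>
      intro _ t _
      simp [fdG, hE1, he, hY0, hYref0]
    | succ j ih =>
      intro hj t ht
      have h1 := (hYderiv j (by omega) t ht).sub (hYrefderiv j (by omega) t ht)
      have h2 := (hGd j 1 le_rfl (by omega) t ht).congr
        (f₁ := Y j - Yref j) (fun s hs => ih (by omega) s hs) (ih (by omega) t ht)
      exact (fd_unique hω t ht).eq_deriv _ h1 h2
  intro i hi
  obtain ⟨κ, hκ, h⟩ := hGb i 1 le_rfl (by omega)
  obtain ⟨M, hM⟩ := hYrefbdd i hi
  refine ⟨κ + |M| * (α / β), by positivity, fun t ht => ?_⟩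
  have h1 : Y i t = fdG k E i 1 t + Yref i t := by rw [← hD i hi t ht]; abel
  have h2 : 1 ≤ (α / β) * ψ t := by
    calc (1 : ℝ) = (α / β) * (β / α) := by field_simp
      _ ≤ _ := mul_le_mul_of_nonneg_left (hψlb t ht) (by positivity)
  have h3 := mul_le_mul_of_nonneg_left h2 (abs_nonneg M)
  rw [h1]
  have h4 := norm_add_le (fdG k E i 1 t) (Yref i t)
  have h5 := h t ht
  have h6 := hM t ht
  have h7 := le_abs_self M
  linarith
end

section
/- Let m ∈ ℕ, ω ∈ (0,∞], ε ∈ (0,1). Let e_r ∈ C¹([0,ω),ℝ^m) and ψ ∈ C¹([0,ω),ℝ) with ψ(t) > 0 for all t ∈ [0,ω), and suppose ‖e_r(0)‖ ≤ ε ψ(0). Assume that for every t ∈ [0,ω) with ‖e_r(t)‖ ≥ ε ψ(t) one has ⟨e_r(t), ė_r(t)⟩ ≤ ε ψ̇(t) ‖e_r(t)‖. Then ‖e_r(t)‖ ≤ ε ψ(t) for all t ∈ [0,ω). -/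
open Set
open scoped ENNReal RealInnerProductSpace

/-- Invariance lemma (skeleton of Step 5 of the main theorem): if `‖e_r(0)‖ ≤ εψ(0)`
and whenever `‖e_r(t)‖ ≥ εψ(t)` one has `⟨e_r(t), ė_r(t)⟩ ≤ εψ̇(t)‖e_r(t)‖`,
then `‖e_r(t)‖ ≤ εψ(t)` for all `t ∈ [0,ω)`. -/
theorem stmt11 (m : ℕ) (ω : ℝ≥0∞) (hω : 0 < ω) (ε : ℝ) (hε0 : 0 < ε) (hε1 : ε < 1)
    (er er' : ℝ → EuclideanSpace ℝ (Fin m))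
    (herderiv : ∀ t ∈ funnelDomain ω, HasDerivWithinAt er (er' t) (funnelDomain ω) t)
    (her'cont : ContinuousOn er' (funnelDomain ω))
    (ψ ψ' : ℝ → ℝ)
    (hψderiv : ∀ t ∈ funnelDomain ω, HasDerivWithinAt ψ (ψ' t) (funnelDomain ω) t)
    (hψ'cont : ContinuousOn ψ' (funnelDomain ω))
    (hψpos : ∀ t ∈ funnelDomain ω, 0 < ψ t)
    (h0 : ‖er 0‖ ≤ ε * ψ 0)
    (hkey : ∀ t ∈ funnelDomain ω, ε * ψ t ≤ ‖er t‖ →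
      ⟪er t, er' t⟫ ≤ ε * ψ' t * ‖er t‖) :
    ∀ t ∈ funnelDomain ω, ‖er t‖ ≤ ε * ψ t := by
  intro T hT
  have hsub : ∀ x ∈ Icc 0 T, x ∈ funnelDomain ω := fun x hx =>
    ⟨hx.1, lt_of_le_of_lt (ENNReal.ofReal_le_ofReal hx.2) hT.2⟩
  have hnhds : ∀ x ∈ Ico 0 T, funnelDomain ω ∈ nhdsWithin x (Ici x) := fun x hx =>
    Filter.mem_of_superset (Icc_mem_nhdsGE hx.2)
      (fun y hy => hsub y ⟨hx.1.trans hy.1, hy.2⟩)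
  have main : ∀ δ : ℝ, 0 < δ → ‖er T‖ ≤ ε * ψ T + δ * (1 + T) := by
    intro δ hδ
    have hBpos : ∀ x ∈ Icc 0 T, 0 < ε * ψ x + δ * (1 + x) := fun x hx => by
      have h1 := hψpos x (hsub x hx)
      have h2 := hx.1
      positivity
    have hfd : ∀ x ∈ funnelDomain ω, HasDerivWithinAt (fun t => ‖er t‖ ^ 2)
        (2 * ⟪er x, er' x⟫) (funnelDomain ω) x := fun x hx => (herderiv x hx).norm_sq
    have hBd : ∀ x ∈ funnelDomain ω, HasDerivWithinAt (fun t => (ε * ψ t + δ * (1 + t)) ^ 2)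
        (2 * (ε * ψ x + δ * (1 + x)) * (ε * ψ' x + δ)) (funnelDomain ω) x := fun x hx => by
      have h1 := (((hψderiv x hx).const_mul ε).add
        (((hasDerivWithinAt_id x (funnelDomain ω)).const_add 1).const_mul δ)).pow 2
      refine HasDerivWithinAt.congr_deriv (f := fun t => (ε * ψ t + δ * (1 + t)) ^ 2) h1 ?_
      simp
    have key := image_le_of_deriv_right_lt_deriv_boundary' (a := 0) (b := T)
      (f := fun t => ‖er t‖ ^ 2) (f' := fun x => 2 * ⟪er x, er' x⟫)
      (B := fun t => (ε * ψ t + δ * (1 + t)) ^ 2)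
      (B' := fun x => 2 * (ε * ψ x + δ * (1 + x)) * (ε * ψ' x + δ))
      (fun x hx => (hfd x (hsub x hx)).continuousWithinAt.mono hsub)
      (fun x hx => (hfd x (hsub x ⟨hx.1, hx.2.le⟩)).mono_of_mem_nhdsWithin (hnhds x hx))
      (by
        have : ‖er 0‖ ≤ ε * ψ 0 + δ * (1 + 0) := by linarith
        exact pow_le_pow_left₀ (norm_nonneg _) this 2)
      (fun x hx => (hBd x (hsub x hx)).continuousWithinAt.mono hsub)
      (fun x hx => (hBd x (hsub x ⟨hx.1, hx.2.le⟩)).mono_of_mem_nhdsWithin (hnhds x hx))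
      (by
        intro x hx heq
        have hx' : x ∈ Icc 0 T := ⟨hx.1, hx.2.le⟩
        have hp := hBpos x hx'
        have he : ‖er x‖ = ε * ψ x + δ * (1 + x) :=
          (pow_left_inj₀ (norm_nonneg _) hp.le two_ne_zero).1 heq
        have hd : 0 ≤ δ * (1 + x) := mul_nonneg hδ.le (by linarith [hx.1])
        have hk := hkey x (hsub x hx') (by linarith)
        rw [he] at hk
        have := mul_pos hp hδ
        show 2 * ⟪er x, er' x⟫ < 2 * (ε * ψ x + δ * (1 + x)) * (ε * ψ' x + δ)
        nlinarith)
    have hTT : T ∈ Icc 0 T := ⟨hT.1, le_rfl⟩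
    exact (pow_le_pow_iff_left₀ (norm_nonneg _) (hBpos T hTT).le two_ne_zero).1 (key hTT)
  refine le_of_forall_pos_le_add fun η hη => ?_
  have hT1 : 0 < 1 + T := by linarith [hT.1]
  have := main (η / (1 + T)) (by positivity)
  rwa [div_mul_cancel₀ _ hT1.ne'] at this
end
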